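/- Let Ẑ be a Hilbert space and K = {y ∈ Ẑ : ⟨y_j, y⟩ + b_j ≤ 0, j = 1,…,n} a nonempty closed polyhedron, where y_j ∈ Ẑ \ {0} and b_j ∈ ℝ. If ξ ∈ Ẑ is nonzero and sup_{y∈K} ⟨ξ, y⟩ < +∞, then this supremum is attained at some ȳ in the boundary of K, and ξ ∈ Σ_{j ∈ In(ȳ)} ℝ₊ y_j, where In(ȳ) = {j : ⟨y_j, ȳ⟩ + b_j = 0}. -/

import Mathlib

open RealInnerProductSpace

/-- **Farkas' lemma** for finitely many linear functionals on a real vector space. -/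
theorem exists_nonneg_sum_eq_of_forall_nonpos {ι E : Type*} [AddCommGroup E] [Module ℝ E]
    (s : Finset ι) (a : ι → E →ₗ[ℝ] ℝ) (g : E →ₗ[ℝ] ℝ)
    (h : ∀ x, (∀ i ∈ s, a i x ≤ 0) → g x ≤ 0) :
    ∃ lam : ι → ℝ, (∀ i, 0 ≤ lam i) ∧ ∀ x, g x = ∑ i ∈ s, lam i * a i x := by
  classical
  induction s using Finset.induction_on generalizing a g with
  | empty =>
    refine ⟨0, fun _ => le_rfl, fun x => ?_⟩
    have h₁ := h x (by simp)
    have h₂ := h (-x) (by simp)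
    rw [map_neg] at h₂
    simp only [Finset.sum_empty]
    linarith
  | insert k s hk ih =>
    by_cases hs : ∀ x, (∀ i ∈ s, a i x ≤ 0) → g x ≤ 0
    · obtain ⟨lam, hlam, hg⟩ := ih a g hs
      refine ⟨Function.update lam k 0, fun i => ?_, fun x => ?_⟩
      · by_cases hik : i = k
        · simp [hik]
        · simpa [hik] using hlam i
      · rw [hg, Finset.sum_insert hk, Function.update_self, zero_mul, zero_add]
        refine Finset.sum_congr rfl fun i hi => ?_
        rw [Function.update_of_ne (ne_of_mem_of_not_mem hi hk)]
    · push Not at hs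
      obtain ⟨z, hz, hgz⟩ := hs
      have hkz : 0 < a k z := by
        by_contra! hcon
        exact hgz.not_ge (h z (Finset.forall_mem_insert _ _ _ |>.2 ⟨hcon, hz⟩))
      obtain ⟨lam, hlam, hg⟩ := ih (fun i => a i - (a i z / a k z) • a k)
        (g - (g z / a k z) • a k) (fun x hx => by
          have key : ∀ f : E →ₗ[ℝ] ℝ,
              f (x - (a k x / a k z) • z) = f x - f z / a k z * a k x := fun f => by
            simp only [map_sub, map_smul, smul_eq_mul]
            ring
          have hp := h (x - (a k x / a k z) • z) (by
            refine Finset.forall_mem_insert _ _ _ |>.2 ⟨?_, fun i hi => ?_⟩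
            · rw [key, div_self hkz.ne']
              simp
            · rw [key]
              simpa using hx i hi)
          rw [key] at hp
          simpa using hp)
      refine ⟨Function.update lam k ((g z - ∑ i ∈ s, lam i * a i z) / a k z),
        fun i => ?_, fun x => ?_⟩
      · by_cases hik : i = k
        · subst hik
          rw [Function.update_self]
          have : ∑ j ∈ s, lam j * a j z ≤ 0 :=
            Finset.sum_nonpos fun j hj => mul_nonpos_of_nonneg_of_nonpos (hlam j) (hz j hj)
          exact div_nonneg (by linarith) hkz.le
        · simpa [hik] using hlam i
      · have hx := hg x
        simp only [LinearMap.sub_apply, LinearMap.smul_apply, smul_eq_mul, mul_sub,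
          Finset.sum_sub_distrib] at hx
        have hpull : ∑ i ∈ s, lam i * (a i z / a k z * a k x)
            = (∑ i ∈ s, lam i * a i z) / a k z * a k x := by
          rw [Finset.sum_div, Finset.sum_mul]
          exact Finset.sum_congr rfl fun i _ => by ring
        have hupd : ∑ i ∈ s, Function.update lam k
            ((g z - ∑ i ∈ s, lam i * a i z) / a k z) i * a i x = ∑ i ∈ s, lam i * a i x :=
          Finset.sum_congr rfl fun i hi => by
            rw [Function.update_of_ne (ne_of_mem_of_not_mem hi hk)]
        rw [Finset.sum_insert hk, Function.update_self, hupd, sub_div, sub_mul]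
        linarith

/-- An infeasible finite system of affine inequalities has a nonnegative certificate of
infeasibility. -/
theorem exists_nonneg_certificate_of_infeasible {ι E : Type*} [Fintype ι] [AddCommGroup E]
    [Module ℝ E] (a : ι → E →ₗ[ℝ] ℝ) (b : ι → ℝ) (h : ¬ ∃ x, ∀ i, a i x + b i ≤ 0) :
    ∃ lam : ι → ℝ, (∀ i, 0 ≤ lam i) ∧ (∀ x, ∑ i, lam i * a i x = 0) ∧
      ∑ i, lam i * b i = 1 := by
  obtain ⟨lam, hlam, hsum⟩ := exists_nonneg_sum_eq_of_forall_nonpos Finset.univ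
    (fun i => (a i).coprod (b i • LinearMap.id)) (LinearMap.snd ℝ E ℝ) (by
      rintro ⟨x, t⟩ hx
      by_contra! ht
      simp only [LinearMap.snd_apply] at ht
      refine h ⟨t⁻¹ • x, fun i => ?_⟩
      have hi : a i x + b i * t ≤ 0 := by simpa using hx i (Finset.mem_univ i)
      have : a i (t⁻¹ • x) + b i = t⁻¹ * (a i x + b i * t) := by
        rw [map_smul, smul_eq_mul]
        field_simp
      rw [this]
      exact mul_nonpos_of_nonneg_of_nonpos (inv_nonneg.2 ht.le) hi)
  refine ⟨lam, hlam, fun x => ?_, ?_⟩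
  · simpa using (hsum (x, 0)).symm
  · simpa using (hsum (0, 1)).symm

/-- **Affine Farkas' lemma**: an affine inequality implied by a feasible finite system of affine
inequalities is a nonnegative combination of them, up to a constant. -/
theorem exists_nonneg_combination_of_forall_le {ι E : Type*} [Fintype ι] [AddCommGroup E]
    [Module ℝ E] (a : ι → E →ₗ[ℝ] ℝ) (b : ι → ℝ) (hne : ∃ x, ∀ i, a i x + b i ≤ 0)
    (g : E →ₗ[ℝ] ℝ) (v : ℝ) (h : ∀ x, (∀ i, a i x + b i ≤ 0) → g x ≤ v) :
    ∃ lam : ι → ℝ, (∀ i, 0 ≤ lam i) ∧ (∀ x, g x = ∑ i, lam i * a i x) ∧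
      0 ≤ v + ∑ i, lam i * b i := by
  obtain ⟨x₀, hx₀⟩ := hne
  obtain ⟨lam, hlam, hsum⟩ := exists_nonneg_sum_eq_of_forall_nonpos Finset.univ
    (fun o : Option ι => o.elim (-LinearMap.snd ℝ E ℝ)
      fun i => (a i).coprod (b i • LinearMap.id))
    (g.coprod (-v • LinearMap.id)) (by
      rintro ⟨x, t⟩ hx
      have ht : 0 ≤ t := by simpa using hx none (Finset.mem_univ _)
      have ha : ∀ i, a i x + b i * t ≤ 0 := fun i => by
        simpa using hx (some i) (Finset.mem_univ _)
      suffices g x ≤ v * t by simpa using this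
      rcases ht.eq_or_lt with rfl | ht
      · simp only [mul_zero, add_zero] at ha ⊢
        by_contra! hgx
        have hr : 0 ≤ (v - g x₀ + 1) / g x :=
          div_nonneg (by linarith [h x₀ hx₀]) hgx.le
        have := h (x₀ + ((v - g x₀ + 1) / g x) • x) fun i => by
          rw [map_add, map_smul, smul_eq_mul]
          linarith [hx₀ i, mul_nonpos_of_nonneg_of_nonpos hr (ha i)]
        rw [map_add, map_smul, smul_eq_mul, div_mul_cancel₀ _ hgx.ne'] at this
        linarith
      · have := h (t⁻¹ • x) fun i => by
          have hi : a i (t⁻¹ • x) + b i = t⁻¹ * (a i x + b i * t) := by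
            rw [map_smul, smul_eq_mul]
            field_simp
          rw [hi]
          exact mul_nonpos_of_nonneg_of_nonpos (inv_nonneg.2 ht.le) (ha i)
        rwa [map_smul, smul_eq_mul, inv_mul_le_iff₀ ht, mul_comm] at this)
  refine ⟨fun i => lam (some i), fun i => hlam _, fun x => ?_, ?_⟩
  · simpa [Fintype.sum_option] using hsum (x, 0)
  · have h₁ : -v = -lam none + ∑ i, lam (some i) * b i := by
      simpa [Fintype.sum_option] using hsum (0, 1)
    linarith [hlam none]

/-- A linear functional bounded above on a nonempty polyhedron attains its supremum. -/
theorem exists_forall_le_of_bddAbove_polyhedron {ι E : Type*} [Fintype ι] [AddCommGroup E]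
    [Module ℝ E] (a : ι → E →ₗ[ℝ] ℝ) (b : ι → ℝ) (hne : ∃ x, ∀ i, a i x + b i ≤ 0)
    (g : E →ₗ[ℝ] ℝ) (hbdd : BddAbove (g '' {x | ∀ i, a i x + b i ≤ 0})) :
    ∃ z, (∀ i, a i z + b i ≤ 0) ∧ ∀ x, (∀ i, a i x + b i ≤ 0) → g x ≤ g z := by
  set S := g '' {x | ∀ i, a i x + b i ≤ 0}
  have hle : ∀ x, (∀ i, a i x + b i ≤ 0) → g x ≤ sSup S := fun x hx =>
    le_csSup hbdd (Set.mem_image_of_mem g hx)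
  by_cases hz : ∃ z, ∀ o : Option ι, o.elim (-g) a z + o.elim (sSup S) b ≤ 0
  · obtain ⟨z, hz⟩ := hz
    refine ⟨z, fun i => hz (some i), fun x hx => (hle x hx).trans ?_⟩
    have : -g z + sSup S ≤ 0 := hz none
    linarith
  · exfalso
    obtain ⟨lam, hlam, hlin, hconst⟩ :=
      exists_nonneg_certificate_of_infeasible _ _ hz
    simp only [Fintype.sum_option, Option.elim_none, Option.elim_some,
      LinearMap.neg_apply] at hlin hconst
    have key : ∀ x, (∀ i, a i x + b i ≤ 0) → 1 ≤ lam none * (sSup S - g x) := fun x hx => by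
      have hnonpos : ∑ i, lam (some i) * (a i x + b i) ≤ 0 :=
        Finset.sum_nonpos fun i _ => mul_nonpos_of_nonneg_of_nonpos (hlam _) (hx i)
      simp only [mul_add, Finset.sum_add_distrib] at hnonpos
      linarith [hlin x]
    obtain ⟨x₀, hx₀⟩ := hne
    have hpos : 0 < lam none := by
      refine (hlam none).lt_of_ne fun h0 => ?_
      have := key x₀ hx₀
      rw [← h0] at this
      linarith
    have hsup : sSup S ≤ sSup S - 1 / lam none := by
      refine csSup_le ⟨g x₀, x₀, hx₀, rfl⟩ ?_
      rintro _ ⟨x, hx, rfl⟩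
      have : 1 / lam none ≤ sSup S - g x := by
        rw [div_le_iff₀ hpos, mul_comm]
        exact key x hx
      linarith
    linarith [one_div_pos.2 hpos]

/-- A maximizer over a set of a nonzero continuous linear functional is not in its interior. -/
theorem notMem_interior_of_forall_inner_le {H : Type*} [NormedAddCommGroup H]
    [InnerProductSpace ℝ H] {K : Set H} {ξ z : H} (hξ : ξ ≠ 0)
    (hmax : ∀ x ∈ K, ⟪ξ, x⟫ ≤ ⟪ξ, z⟫) : z ∉ interior K := by
  intro hz
  have hcont : Filter.Tendsto (fun t : ℝ => z + t • ξ) (nhdsWithin 0 (Set.Ioi 0)) (nhds z) := by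
    have : Continuous fun t : ℝ => z + t • ξ := by fun_prop
    simpa using (this.tendsto 0).mono_left nhdsWithin_le_nhds
  obtain ⟨t, htK, ht⟩ := ((hcont.eventually (mem_interior_iff_mem_nhds.1 hz)).and
    self_mem_nhdsWithin).exists
  have h := hmax _ htK
  rw [inner_add_right, real_inner_smul_right] at h
  have := mul_pos (Set.mem_Ioi.1 ht) (real_inner_self_pos.2 hξ)
  linarith

/-- Support of a linear functional on a nonempty closed polyhedron in a Hilbert space:
if `ξ ≠ 0` and `sup_{y ∈ K} ⟪ξ, y⟫ < ∞`, the supremum is attained at a boundary point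
`ȳ`, and `ξ` is a nonnegative combination of the constraints active at `ȳ`. -/
theorem polyhedron_sup_attained_and_active_representation
    {H : Type*} [NormedAddCommGroup H] [InnerProductSpace ℝ H] [CompleteSpace H]
    (n : ℕ) (y : Fin n → H) (hy : ∀ j, y j ≠ 0) (b : Fin n → ℝ)
    (K : Set H) (hK : K = {x : H | ∀ j, ⟪y j, x⟫ + b j ≤ 0}) (hne : K.Nonempty)
    (ξ : H) (hξ : ξ ≠ 0) (hbdd : BddAbove ((fun x => ⟪ξ, x⟫) '' K)) :
    ∃ ybar ∈ K, ybar ∈ frontier K ∧ (∀ x ∈ K, ⟪ξ, x⟫ ≤ ⟪ξ, ybar⟫) ∧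
      ∃ lam : Fin n → ℝ, (∀ j, 0 ≤ lam j) ∧
        (∀ j, lam j ≠ 0 → ⟪y j, ybar⟫ + b j = 0) ∧
        ξ = ∑ j, lam j • y j := by
  subst hK
  obtain ⟨z, hz, hmax⟩ := exists_forall_le_of_bddAbove_polyhedron
    (fun j => innerₗ H (y j)) b hne (innerₗ H ξ) hbdd
  obtain ⟨lam, hlam, hlin, hconst⟩ := exists_nonneg_combination_of_forall_le
    (fun j => innerₗ H (y j)) b hne (innerₗ H ξ) _ hmax
  simp only [innerₗ_apply_apply] at hz hmax hlin hconst
  refine ⟨z, hz, ⟨subset_closure hz, notMem_interior_of_forall_inner_le hξ hmax⟩, hmax,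
    lam, hlam, fun j hj => ?_, ?_⟩
  · have hterm : ∀ i ∈ Finset.univ, lam i * (⟪y i, z⟫ + b i) ≤ 0 := fun i _ =>
      mul_nonpos_of_nonneg_of_nonpos (hlam i) (hz i)
    have hsum : ∑ i, lam i * (⟪y i, z⟫ + b i) = 0 := by
      refine le_antisymm (Finset.sum_nonpos hterm) ?_
      simp only [mul_add, Finset.sum_add_distrib]
      rwa [← hlin z]
    exact (mul_eq_zero.1 ((Finset.sum_eq_zero_iff_of_nonpos hterm).1 hsum j
      (Finset.mem_univ j))).resolve_left hj
  · refine ext_inner_right ℝ fun x => ?_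
    simp only [hlin x, sum_inner, real_inner_smul_left]
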